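/- arXiv:1903.05869 — 2 statements merged into one kernel-verified Lean document; each statement's English description precedes it below -/
import Mathlib

section
/- Let p : [0,1] → [1,∞] be Lebesgue measurable and let f : [0,∞) → X be asymptotically Stepanov p(x)-almost periodic, i.e. f = g|_{[0,∞)} + q where g ∈ L_S^{p(x)}(ℝ:X) is Stepanov p(x)-almost periodic, q ∈ L_S^{p(x)}([0,∞):X) and ‖q(t+·)‖_{L^{p(x)}([0,1]:X)} → 0 as t → +∞. Then f is asymptotically Stepanov p(x)-almost automorphic. -/
open MeasureTheory Filter Topology Set
open scoped ENNReal

noncomputable section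

/-- φ_{p(x)}(t): t^{p(x)} if p(x) < ∞; if p(x) = ∞ then 0 for t ≤ 1 and ∞ for t > 1. -/
def phiVar (p : ℝ → ℝ≥0∞) (x : ℝ) (t : ℝ) : ℝ≥0∞ :=
  if p x ≠ ∞ then ENNReal.ofReal (t ^ (p x).toReal)
  else if t ≤ 1 then 0 else ∞

/-- ρ(u) := ∫_{[0,1]} φ_{p(x)}(u(x)) dx, for a scalar (norm-valued) function u. -/
def rhoVar (p : ℝ → ℝ≥0∞) (u : ℝ → ℝ) : ℝ≥0∞ :=
  ∫⁻ x in Set.Icc (0:ℝ) 1, phiVar p x (u x)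

/-- Membership in L^{p(x)}([0,1]:E). -/
def MemLpVar {E : Type*} [NormedAddCommGroup E] (p : ℝ → ℝ≥0∞) (f : ℝ → E) : Prop :=
  AEStronglyMeasurable f (volume.restrict (Set.Icc (0:ℝ) 1)) ∧
    ∃ c : ℝ, 0 < c ∧ rhoVar p (fun x => c * ‖f x‖) < ∞

/-- The Luxemburg norm of f in L^{p(x)}([0,1]:E). -/
def luxNorm {E : Type*} [NormedAddCommGroup E] (p : ℝ → ℝ≥0∞) (f : ℝ → E) : ℝ :=
  sInf {lam : ℝ | 0 < lam ∧ rhoVar p (fun x => ‖f x‖ / lam) ≤ 1}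

/-- Stepanov p(x)-boundedness on the interval I. -/
def SBdd {E : Type*} [NormedAddCommGroup E] (p : ℝ → ℝ≥0∞) (I : Set ℝ) (f : ℝ → E) : Prop :=
  (∀ t ∈ I, MemLpVar p (fun x => f (t + x))) ∧
    BddAbove ((fun t => luxNorm p (fun x => f (t + x))) '' I)

/-- The Stepanov norm ‖f‖_{S^{p(x)}} on the interval I. -/
def SNorm {E : Type*} [NormedAddCommGroup E] (p : ℝ → ℝ≥0∞) (I : Set ℝ) (f : ℝ → E) : ℝ :=
  sSup ((fun t => luxNorm p (fun x => f (t + x))) '' I)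

/-- Stepanov p(x)-almost automorphy (AAS^{p(x)}(ℝ:E)). -/
def AASVar {E : Type*} [NormedAddCommGroup E] (p : ℝ → ℝ≥0∞) (f : ℝ → E) : Prop :=
  SBdd p Set.univ f ∧
    ∀ a : ℕ → ℝ, ∃ n : ℕ → ℕ, StrictMono n ∧ ∃ g : ℝ → E, SBdd p Set.univ g ∧
      ∀ t : ℝ,
        Tendsto (fun k => luxNorm p (fun x => f (a (n k) + t + x) - g (t + x))) atTop (𝓝 0) ∧
        Tendsto (fun k => luxNorm p (fun x => g (t - a (n k) + x) - f (t + x))) atTop (𝓝 0)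

/-- The class S_0^{p(x)}([0,∞):E) of Stepanov vanishing functions. -/
def S0Var {E : Type*} [NormedAddCommGroup E] (p : ℝ → ℝ≥0∞) (f : ℝ → E) : Prop :=
  SBdd p (Set.Ici 0) f ∧ Tendsto (fun t => luxNorm p (fun x => f (t + x))) atTop (𝓝 0)

/-- Asymptotic Stepanov p(x)-almost automorphy (AAAS^{p(x)}([0,∞):E)). -/
def AAASVar {E : Type*} [NormedAddCommGroup E] (p : ℝ → ℝ≥0∞) (f : ℝ → E) : Prop :=
  SBdd p (Set.Ici 0) f ∧
    ∃ g q : ℝ → E, AASVar p g ∧ SBdd p (Set.Ici 0) q ∧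
      (∀ t : ℝ, 0 ≤ t → f t = g t + q t) ∧
      Tendsto (fun t => luxNorm p (fun x => q (t + x))) atTop (𝓝 0)

/-- Stepanov p(x)-almost periodicity on I: the map t ↦ f(t+·) is Bohr almost periodic
from I to L^{p(x)}([0,1]:E), i.e. continuous plus the relative density of ε-periods. -/
def APSVar {E : Type*} [NormedAddCommGroup E] (p : ℝ → ℝ≥0∞) (I : Set ℝ) (f : ℝ → E) : Prop :=
  SBdd p I f ∧
    (∀ t ∈ I, Tendsto (fun s => luxNorm p (fun x => f (s + x) - f (t + x))) (𝓝[I] t) (𝓝 0)) ∧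
    ∀ ε : ℝ, 0 < ε → ∃ l : ℝ, 0 < l ∧ ∀ a : ℝ, Set.Icc a (a + l) ⊆ I →
      ∃ τ ∈ Set.Icc a (a + l), ∀ t ∈ I, luxNorm p (fun x => f (t + τ + x) - f (t + x)) ≤ ε

/-- Almost automorphic function ℝ → E. -/
def AlmostAutomorphic {E : Type*} [NormedAddCommGroup E] (f : ℝ → E) : Prop :=
  Continuous f ∧
    ∀ b : ℕ → ℝ, ∃ n : ℕ → ℕ, StrictMono n ∧ ∃ g : ℝ → E,
      (∀ t : ℝ, Tendsto (fun k => f (t + b (n k))) atTop (𝓝 (g t))) ∧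
      (∀ t : ℝ, Tendsto (fun k => g (t - b (n k))) atTop (𝓝 (f t)))

/-- Compactly almost automorphic function ℝ → E. -/
def CompactAA {E : Type*} [NormedAddCommGroup E] (f : ℝ → E) : Prop :=
  Continuous f ∧
    ∀ b : ℕ → ℝ, ∃ n : ℕ → ℕ, StrictMono n ∧ ∃ g : ℝ → E,
      (∀ K : Set ℝ, IsCompact K →
        TendstoUniformlyOn (fun k t => f (t + b (n k))) g atTop K) ∧
      (∀ K : Set ℝ, IsCompact K →
        TendstoUniformlyOn (fun k t => g (t - b (n k))) f atTop K)

/-- Two-parameter Stepanov p(x)-almost automorphy (AAS^{p(x)}(ℝ×F:E)). -/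
def AAS2Var {E F : Type*} [NormedAddCommGroup E] [NormedAddCommGroup F]
    (p : ℝ → ℝ≥0∞) (f : ℝ → F → E) : Prop :=
  (∀ y : F, SBdd p Set.univ (fun t => f t y)) ∧
    ∀ a : ℕ → ℝ, ∃ n : ℕ → ℕ, StrictMono n ∧ ∃ g : ℝ → F → E,
      (∀ y : F, SBdd p Set.univ (fun t => g t y)) ∧
      ∀ (t : ℝ) (y : F),
        Tendsto (fun k => luxNorm p (fun x => f (t + a (n k) + x) y - g (t + x) y)) atTop (𝓝 0) ∧
        Tendsto (fun k => luxNorm p (fun x => g (t - a (n k) + x) y - f (t + x) y)) atTop (𝓝 0)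


/-- A point of the line, used to carry an auxiliary pseudo-metric. -/
structure AuxPt where
  val : ℝ

theorem cauchy_subseq_of_totallyBounded {Y : Type*} [PseudoMetricSpace Y]
    (h : TotallyBounded (Set.univ : Set Y)) (a : ℕ → Y) :
    ∃ n : ℕ → ℕ, StrictMono n ∧ CauchySeq (a ∘ n) := by
  have h1 : TotallyBounded (Set.range ((↑) : Y → UniformSpace.Completion Y)) := by
    rw [← Set.image_univ]
    exact h.image (UniformSpace.Completion.uniformContinuous_coe Y)
  have h2 : IsCompact (closure (Set.range ((↑) : Y → UniformSpace.Completion Y))) :=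
    h1.closure.isCompact_of_isClosed isClosed_closure
  obtain ⟨y, -, n, hn, hy⟩ := h2.tendsto_subseq
    (x := fun k => ((a k : Y) : UniformSpace.Completion Y))
    (fun k => subset_closure (Set.mem_range_self _))
  refine ⟨n, hn, ?_⟩
  have h3 := hy.cauchySeq
  rw [Metric.cauchySeq_iff] at h3 ⊢
  intro ε hε
  obtain ⟨N, hN⟩ := h3 ε hε
  refine ⟨N, fun m hm k hk => ?_⟩
  have := hN m hm k hk
  simpa [UniformSpace.Completion.dist_eq] using this

theorem ap_unif_cont (d : ℝ → ℝ → ℝ) (h0 : ∀ s, d s s = 0)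
    (hs : ∀ s t, d s t = d t s) (ht : ∀ r s t, d r t ≤ d r s + d s t)
    (hc : ∀ t : ℝ, Tendsto (fun s => d s t) (𝓝 t) (𝓝 0))
    (hap : ∀ ε : ℝ, 0 < ε → ∃ l : ℝ, 0 < l ∧ ∀ a : ℝ,
      ∃ τ ∈ Set.Icc a (a + l), ∀ t, d (t + τ) t ≤ ε) (ε : ℝ) (hε : 0 < ε) :
    ∃ δ : ℝ, 0 < δ ∧ ∀ s t, |s - t| < δ → d s t ≤ ε := by
  let _ : PseudoMetricSpace AuxPt :=
    { dist := fun x y => d x.val y.val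
      dist_self := fun x => h0 _
      dist_comm := fun x y => hs _ _
      dist_triangle := fun x y z => ht _ _ _ }
  obtain ⟨l, hl, hτ⟩ := hap (ε / 3) (by positivity)
  have hcont : Continuous (fun t : ℝ => AuxPt.mk t) := by
    rw [continuous_iff_continuousAt]
    intro t
    exact tendsto_iff_dist_tendsto_zero.2 (hc t)
  have huc := (isCompact_Icc (a := (-1 : ℝ)) (b := l + 1)).uniformContinuousOn_of_continuous
    hcont.continuousOn
  rw [Metric.uniformContinuousOn_iff] at huc
  obtain ⟨δ, hδ, h⟩ := huc (ε / 3) (by positivity)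
  refine ⟨min δ 1, by positivity, fun s t hst => ?_⟩
  obtain ⟨τ, hτ1, hτ2⟩ := hτ (-s)
  have hst1 : |s - t| < δ := lt_of_lt_of_le hst (min_le_left _ _)
  have hst2 := abs_lt.1 (lt_of_lt_of_le hst (min_le_right _ _))
  have h3 : d (s + τ) (t + τ) < ε / 3 := by
    refine h (s + τ) ⟨?_, ?_⟩ (t + τ) ⟨?_, ?_⟩ ?_
    · linarith [hτ1.1, hτ1.2]
    · linarith [hτ1.1, hτ1.2]
    · linarith [hτ1.1, hτ1.2]
    · linarith [hτ1.1, hτ1.2]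
    · rw [Real.dist_eq]
      convert hst1 using 2
      ring
  have h4 := hτ2 s
  have h5 := hτ2 t
  rw [hs] at h4
  linarith [ht s (s + τ) t, ht (s + τ) (t + τ) t]

theorem ap_bochner (d : ℝ → ℝ → ℝ) (h0 : ∀ s, d s s = 0)
    (hs : ∀ s t, d s t = d t s) (ht : ∀ r s t, d r t ≤ d r s + d s t)
    (hc : ∀ t : ℝ, Tendsto (fun s => d s t) (𝓝 t) (𝓝 0))
    (hap : ∀ ε : ℝ, 0 < ε → ∃ l : ℝ, 0 < l ∧ ∀ a : ℝ,
      ∃ τ ∈ Set.Icc a (a + l), ∀ t, d (t + τ) t ≤ ε)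
    (B : ℝ) (hB : ∀ s t, d s t ≤ B) (a : ℕ → ℝ) :
    ∃ n : ℕ → ℕ, StrictMono n ∧ ∀ ε : ℝ, 0 < ε → ∃ N, ∀ j ≥ N, ∀ k ≥ N, ∀ t,
      d (a (n j) + t) (a (n k) + t) ≤ ε := by
  have hbd : ∀ x y : ℝ, BddAbove (Set.range fun t => d (x + t) (y + t)) := fun x y =>
    ⟨B, by rintro _ ⟨t, rfl⟩; exact hB _ _⟩
  let _ : PseudoMetricSpace AuxPt :=
    { dist := fun x y => ⨆ t : ℝ, d (x.val + t) (y.val + t)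
      dist_self := fun x => by simp [h0]
      dist_comm := fun x y => by
        show (⨆ t : ℝ, d (x.val + t) (y.val + t)) = ⨆ t : ℝ, d (y.val + t) (x.val + t)
        congr 1; funext t; exact hs _ _
      dist_triangle := fun x y z => by
        refine ciSup_le fun t => ?_
        exact (ht _ (y.val + t) _).trans
          (add_le_add (le_ciSup (hbd x.val y.val) t) (le_ciSup (hbd y.val z.val) t)) }
  have hdist : ∀ x y : AuxPt, ∀ t, d (x.val + t) (y.val + t) ≤ dist x y := fun x y t =>
    le_ciSup (hbd x.val y.val) t
  have hdle : ∀ (x y : AuxPt) (e : ℝ), (∀ t, d (x.val + t) (y.val + t) ≤ e) → dist x y ≤ e :=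
    fun x y e h => ciSup_le h
  have htb : TotallyBounded (Set.univ : Set AuxPt) := by
    rw [Metric.totallyBounded_iff]
    intro ε hε
    obtain ⟨δ, hδ, huc⟩ := ap_unif_cont d h0 hs ht hc hap (ε / 3) (by positivity)
    obtain ⟨l, hl, hτ⟩ := hap (ε / 3) (by positivity)
    obtain ⟨T, hT, hcov⟩ := Metric.totallyBounded_iff.1
      (isCompact_Icc (a := (0 : ℝ)) (b := l)).totallyBounded δ hδ
    refine ⟨AuxPt.mk '' T, hT.image _, fun x _ => ?_⟩
    obtain ⟨τ, hτ1, hτ2⟩ := hτ (-x.val)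
    have hmem : x.val + τ ∈ Set.Icc 0 l := ⟨by linarith [hτ1.1], by linarith [hτ1.2]⟩
    have := hcov hmem
    simp only [Set.mem_iUnion, Metric.mem_ball, exists_prop] at this
    obtain ⟨y, hy, hxy⟩ := this
    simp only [Set.mem_iUnion, Metric.mem_ball, exists_prop]
    refine ⟨AuxPt.mk y, Set.mem_image_of_mem _ hy, ?_⟩
    have h6 : dist x (AuxPt.mk y) ≤ ε / 3 + ε / 3 := by
      apply hdle
      intro t
      have h7 := hτ2 (x.val + t)
      rw [hs] at h7
      have h8 := huc (x.val + t + τ) (y + t) (by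
        rw [Real.dist_eq] at hxy
        convert hxy using 2
        ring)
      exact (ht _ (x.val + t + τ) _).trans (add_le_add h7 h8)
    linarith
  obtain ⟨n, hn, hC⟩ := cauchy_subseq_of_totallyBounded htb (fun k => AuxPt.mk (a k))
  refine ⟨n, hn, fun ε hε => ?_⟩
  obtain ⟨N, hN⟩ := Metric.cauchySeq_iff.1 hC ε hε
  exact ⟨N, fun j hj k hk t => (hdist _ _ t).trans (hN j hj k hk).le⟩

theorem phiVar_mono (p : ℝ → ℝ≥0∞) (x : ℝ) {s t : ℝ} (hs : 0 ≤ s) (hst : s ≤ t) :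
    phiVar p x s ≤ phiVar p x t := by
  unfold phiVar
  split_ifs with h1 h2 h3 h3
  · exact ENNReal.ofReal_le_ofReal (Real.rpow_le_rpow hs hst ENNReal.toReal_nonneg)
  · simp
  · simp
  · exact absurd (hst.trans h3) h2
  · simp

theorem phiVar_zero (p : ℝ → ℝ≥0∞) (x : ℝ) (hx : 1 ≤ p x) : phiVar p x 0 = 0 := by
  unfold phiVar
  split_ifs with h1 h2
  · have : 1 ≤ (p x).toReal := by simpa using ENNReal.toReal_mono h1 hx
    rw [Real.zero_rpow (by linarith)]; simp
  · rfl
  · exact absurd zero_le_one h2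

theorem phiVar_convex (p : ℝ → ℝ≥0∞) (x : ℝ) (hx : 1 ≤ p x) {s t α β : ℝ} (hs : 0 ≤ s)
    (ht : 0 ≤ t) (hα : 0 < α) (hβ : 0 < β) (hαβ : α + β = 1) :
    phiVar p x (α * s + β * t) ≤
      ENNReal.ofReal α * phiVar p x s + ENNReal.ofReal β * phiVar p x t := by
  unfold phiVar
  by_cases h1 : p x ≠ ∞
  · simp only [if_pos h1]
    have h2 : 1 ≤ (p x).toReal := by simpa using ENNReal.toReal_mono h1 hx
    have h3 := (convexOn_rpow h2).2 (x := s) hs (y := t) ht hα.le hβ.le hαβ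
    rw [← ENNReal.ofReal_mul hα.le, ← ENNReal.ofReal_mul hβ.le,
      ← ENNReal.ofReal_add (by positivity) (by positivity)]
    exact ENNReal.ofReal_le_ofReal (by simpa using h3)
  · simp only [if_neg h1]
    by_cases h2 : s ≤ 1
    · by_cases h3 : t ≤ 1
      · rw [if_pos]
        · exact zero_le
        · nlinarith
      · rw [if_neg h3, ENNReal.mul_top (by simpa using hβ)]
        simp
    · rw [if_neg h2, ENNReal.mul_top (by simpa using hα)]
      simp

theorem phiVar_scale (p : ℝ → ℝ≥0∞) (x : ℝ) (hx : 1 ≤ p x) {s α : ℝ} (hs : 0 ≤ s)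
    (hα : 0 < α) (hα1 : α < 1) :
    phiVar p x (α * s) ≤ ENNReal.ofReal α * phiVar p x s := by
  have := phiVar_convex p x hx hs le_rfl hα (sub_pos.2 hα1) (by ring)
  simpa [phiVar_zero p x hx] using this

theorem le_phiVar (p : ℝ → ℝ≥0∞) (x : ℝ) (hx : 1 ≤ p x) (t : ℝ) :
    ENNReal.ofReal t ≤ 1 + phiVar p x t := by
  by_cases ht : t ≤ 1
  · calc ENNReal.ofReal t ≤ 1 := by simpa using ht
      _ ≤ _ := le_self_add
  · refine le_trans ?_ le_add_self
    unfold phiVar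
    split_ifs with h1
    · have h2 : 1 ≤ (p x).toReal := by simpa using ENNReal.toReal_mono h1 hx
      apply ENNReal.ofReal_le_ofReal
      exact Real.self_le_rpow_of_one_le (by linarith) h2
    · simp

theorem phiVar_measurable (p : ℝ → ℝ≥0∞) (hp : Measurable p) :
    Measurable (fun z : ℝ × ℝ => phiVar p z.1 z.2) := by
  unfold phiVar
  have hm : Measurable (fun z : ℝ × ℝ => p z.1) := hp.comp measurable_fst
  refine Measurable.ite ?_ ?_ (Measurable.ite ?_ measurable_const measurable_const)
  · exact (hm (measurableSet_singleton ∞)).compl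
  · exact (measurable_snd.pow hm.ennreal_toReal).ennreal_ofReal
  · exact measurableSet_le measurable_snd measurable_const

theorem phiVar_lsc (p : ℝ → ℝ≥0∞) (x : ℝ) (hx : 1 ≤ p x) (u : ℕ → ℝ) (t : ℝ)
    (hu : Tendsto u atTop (𝓝 t)) :
    phiVar p x t ≤ liminf (fun n => phiVar p x (u n)) atTop := by
  unfold phiVar
  by_cases h1 : p x ≠ ∞
  · simp only [if_pos h1]
    refine le_of_eq (Tendsto.liminf_eq ?_).symm
    exact ENNReal.tendsto_ofReal (hu.rpow_const (Or.inr ENNReal.toReal_nonneg))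
  · simp only [if_neg h1]
    split_ifs with h2
    · exact zero_le
    · have : ∀ᶠ n in atTop, (∞ : ℝ≥0∞) = if u n ≤ 1 then 0 else ∞ := by
        filter_upwards [hu.eventually (lt_mem_nhds (not_le.1 h2))] with n hn
        rw [if_neg (not_le.2 hn)]
      refine le_of_eq (Tendsto.liminf_eq ?_).symm
      exact tendsto_const_nhds.congr' this

/-- `lam` is an admissible constant in the Luxemburg infimum. -/
def LuxG {E : Type*} [NormedAddCommGroup E] (p : ℝ → ℝ≥0∞) (f : ℝ → E) (lam : ℝ) : Prop :=
  0 < lam ∧ rhoVar p (fun x => ‖f x‖ / lam) ≤ 1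

section lux
variable {E : Type*} [NormedAddCommGroup E] {p : ℝ → ℝ≥0∞}

theorem phiVar_aemeas (hp : Measurable p) {f : ℝ → E}
    (hf : AEStronglyMeasurable f (volume.restrict (Set.Icc (0:ℝ) 1))) (lam : ℝ) :
    AEMeasurable (fun x => phiVar p x (‖f x‖ / lam)) (volume.restrict (Set.Icc (0:ℝ) 1)) :=
  (phiVar_measurable p hp).comp_aemeasurable
    (aemeasurable_id.prodMk (hf.norm.aemeasurable.div_const lam))

theorem luxG_mono {f : ℝ → E} {l m : ℝ} (h : LuxG p f l) (hlm : l ≤ m) : LuxG p f m := by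
  have hl := h.1
  refine ⟨by linarith, le_trans (lintegral_mono fun x => ?_) h.2⟩
  have hm : 0 < m := by linarith
  exact phiVar_mono p x (by positivity) (div_le_div_of_nonneg_left (norm_nonneg _) hl hlm)

theorem luxNorm_bdd (f : ℝ → E) :
    BddBelow {lam : ℝ | 0 < lam ∧ rhoVar p (fun x => ‖f x‖ / lam) ≤ 1} :=
  ⟨0, fun _ h => h.1.le⟩

theorem luxNorm_le {f : ℝ → E} {l : ℝ} (h : LuxG p f l) : luxNorm p f ≤ l :=
  csInf_le (luxNorm_bdd f) h

theorem luxNorm_nonneg (f : ℝ → E) : 0 ≤ luxNorm p f :=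
  Real.sInf_nonneg fun _ h => h.1.le

theorem luxG_exists (hp1 : ∀ x ∈ Set.Icc (0:ℝ) 1, 1 ≤ p x) {f : ℝ → E}
    (h : MemLpVar p f) : ∃ l, LuxG p f l := by
  obtain ⟨-, c, hc, hR⟩ := h
  set R := rhoVar p (fun x => c * ‖f x‖) with hRdef
  set θ : ℝ := 1 / (R.toReal + 2) with hθ
  have hR0 : 0 ≤ R.toReal := ENNReal.toReal_nonneg
  have hθ0 : 0 < θ := by positivity
  have hθ1 : θ < 1 := by
    rw [hθ, div_lt_one (by positivity)]; linarith
  refine ⟨1 / (c * θ), by positivity, ?_⟩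
  have h1 : rhoVar p (fun x => ‖f x‖ / (1 / (c * θ))) ≤ ENNReal.ofReal θ * R := by
    rw [hRdef]
    unfold rhoVar
    rw [← lintegral_const_mul' _ _ ENNReal.ofReal_ne_top]
    refine setLIntegral_mono' measurableSet_Icc fun x hx => ?_
    have : ‖f x‖ / (1 / (c * θ)) = θ * (c * ‖f x‖) := by
      rw [div_div_eq_mul_div, div_one]; ring
    beta_reduce
    rw [this]
    exact phiVar_scale p x (hp1 x hx) (by positivity) hθ0 hθ1
  refine h1.trans ?_
  rw [← ENNReal.ofReal_toReal hR.ne, ← ENNReal.ofReal_mul hθ0.le, ENNReal.ofReal_le_one, hθ,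
    div_mul_eq_mul_div, div_le_one (by positivity)]
  linarith

theorem luxG_of_lt (hp1 : ∀ x ∈ Set.Icc (0:ℝ) 1, 1 ≤ p x) {f : ℝ → E}
    (h : MemLpVar p f) {l : ℝ} (hl : luxNorm p f < l) : LuxG p f l := by
  obtain ⟨m, hm, hml⟩ := exists_lt_of_csInf_lt (luxG_exists hp1 h) hl
  exact luxG_mono hm hml.le

theorem memLpVar_of_luxG {f : ℝ → E} {l : ℝ}
    (hf : AEStronglyMeasurable f (volume.restrict (Set.Icc (0:ℝ) 1))) (h : LuxG p f l) :
    MemLpVar p f := by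
  refine ⟨hf, l⁻¹, inv_pos.2 h.1, ?_⟩
  refine lt_of_le_of_lt ?_ ENNReal.one_lt_top
  simpa [div_eq_inv_mul] using h.2

theorem luxG_add (hp : Measurable p) (hp1 : ∀ x ∈ Set.Icc (0:ℝ) 1, 1 ≤ p x) {f u v : ℝ → E}
    (hu : AEStronglyMeasurable u (volume.restrict (Set.Icc (0:ℝ) 1)))
    {l m : ℝ} (hul : LuxG p u l) (hvm : LuxG p v m) (hle : ∀ x, ‖f x‖ ≤ ‖u x‖ + ‖v x‖) :
    LuxG p f (l + m) := by
  have hl := hul.1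
  have hm := hvm.1
  refine ⟨by positivity, ?_⟩
  have hα : 0 < l / (l + m) := by positivity
  have hβ : 0 < m / (l + m) := by positivity
  have hαβ : l / (l + m) + m / (l + m) = 1 := by field_simp
  calc rhoVar p (fun x => ‖f x‖ / (l + m))
      ≤ ∫⁻ x in Set.Icc (0:ℝ) 1, (ENNReal.ofReal (l / (l + m)) * phiVar p x (‖u x‖ / l)
          + ENNReal.ofReal (m / (l + m)) * phiVar p x (‖v x‖ / m)) := by
        refine setLIntegral_mono' measurableSet_Icc fun x hx => ?_
        refine le_trans ?_ (phiVar_convex p x (hp1 x hx) (by positivity) (by positivity)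
          hα hβ hαβ)
        refine phiVar_mono p x (by positivity) ?_
        have : l / (l + m) * (‖u x‖ / l) + m / (l + m) * (‖v x‖ / m)
            = (‖u x‖ + ‖v x‖) / (l + m) := by field_simp
        rw [this]
        exact div_le_div_of_nonneg_right (hle x) (by positivity)
    _ = ENNReal.ofReal (l / (l + m)) * rhoVar p (fun x => ‖u x‖ / l)
          + ENNReal.ofReal (m / (l + m)) * rhoVar p (fun x => ‖v x‖ / m) := by
        rw [lintegral_add_left' ((phiVar_aemeas hp hu l).const_mul _),
          lintegral_const_mul' _ _ ENNReal.ofReal_ne_top,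
          lintegral_const_mul' _ _ ENNReal.ofReal_ne_top]
        rfl
    _ ≤ ENNReal.ofReal (l / (l + m)) * 1 + ENNReal.ofReal (m / (l + m)) * 1 := by
        gcongr
        · exact hul.2
        · exact hvm.2
    _ = 1 := by
        rw [mul_one, mul_one, ← ENNReal.ofReal_add hα.le hβ.le, hαβ, ENNReal.ofReal_one]

theorem luxNorm_add (hp : Measurable p) (hp1 : ∀ x ∈ Set.Icc (0:ℝ) 1, 1 ≤ p x) {f u v : ℝ → E}
    (hu : MemLpVar p u) (hv : MemLpVar p v) (hle : ∀ x, ‖f x‖ ≤ ‖u x‖ + ‖v x‖) :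
    luxNorm p f ≤ luxNorm p u + luxNorm p v := by
  refine le_of_forall_pos_le_add fun ε hε => ?_
  have h1 := luxG_of_lt hp1 hu (l := luxNorm p u + ε / 2) (by linarith)
  have h2 := luxG_of_lt hp1 hv (l := luxNorm p v + ε / 2) (by linarith)
  have := luxNorm_le (luxG_add hp hp1 hu.1 h1 h2 hle)
  linarith

theorem memLpVar_sub (hp : Measurable p) (hp1 : ∀ x ∈ Set.Icc (0:ℝ) 1, 1 ≤ p x) {u v : ℝ → E}
    (hu : MemLpVar p u) (hv : MemLpVar p v) : MemLpVar p (fun x => u x - v x) := by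
  obtain ⟨l, hl⟩ := luxG_exists hp1 hu
  obtain ⟨m, hm⟩ := luxG_exists hp1 hv
  exact memLpVar_of_luxG (hu.1.sub hv.1) (luxG_add hp hp1 hu.1 hl hm fun x => norm_sub_le _ _)

theorem luxG_fatou (hp : Measurable p) (hp1 : ∀ x ∈ Set.Icc (0:ℝ) 1, 1 ≤ p x) {f : ℝ → E}
    {u : ℕ → ℝ → E} {l : ℝ}
    (hu : ∀ k, AEStronglyMeasurable (u k) (volume.restrict (Set.Icc (0:ℝ) 1)))
    (hl : ∀ k, LuxG p (u k) l)
    (hlim : ∀ᵐ x ∂(volume.restrict (Set.Icc (0:ℝ) 1)),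
      Tendsto (fun k => u k x) atTop (𝓝 (f x))) : LuxG p f l := by
  refine ⟨(hl 0).1, ?_⟩
  calc rhoVar p (fun x => ‖f x‖ / l)
      ≤ ∫⁻ x in Set.Icc (0:ℝ) 1, liminf (fun k => phiVar p x (‖u k x‖ / l)) atTop := by
        refine lintegral_mono_ae ?_
        filter_upwards [hlim, ae_restrict_mem measurableSet_Icc] with x hx hx1
        exact phiVar_lsc p x (hp1 x hx1) _ _ (hx.norm.div_const l)
    _ ≤ liminf (fun k => ∫⁻ x in Set.Icc (0:ℝ) 1, phiVar p x (‖u k x‖ / l)) atTop :=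
        lintegral_liminf_le' fun k => phiVar_aemeas hp (hu k) l
    _ ≤ liminf (fun _ : ℕ => (1 : ℝ≥0∞)) atTop :=
        liminf_le_liminf (Eventually.of_forall fun k => (hl k).2)
    _ = 1 := by simp

theorem luxG_l1 (hp1 : ∀ x ∈ Set.Icc (0:ℝ) 1, 1 ≤ p x) {f : ℝ → E} {l : ℝ} (h : LuxG p f l) :
    ∫⁻ x in Set.Icc (0:ℝ) 1, ‖f x‖ₑ ≤ ENNReal.ofReal l * 2 := by
  have hl := h.1
  calc ∫⁻ x in Set.Icc (0:ℝ) 1, ‖f x‖ₑ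
      ≤ ∫⁻ x in Set.Icc (0:ℝ) 1, ENNReal.ofReal l * (1 + phiVar p x (‖f x‖ / l)) := by
        refine setLIntegral_mono' measurableSet_Icc fun x hx => ?_
        have h2 : ‖f x‖ₑ = ENNReal.ofReal l * ENNReal.ofReal (‖f x‖ / l) := by
          rw [← ENNReal.ofReal_mul hl.le, mul_div_cancel₀ _ hl.ne', ofReal_norm]
        rw [h2]
        gcongr
        exact le_phiVar p x (hp1 x hx) _
    _ = ENNReal.ofReal l * (1 + rhoVar p (fun x => ‖f x‖ / l)) := by
        rw [lintegral_const_mul' _ _ ENNReal.ofReal_ne_top,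
          lintegral_add_left' aemeasurable_const]
        simp [rhoVar]
    _ ≤ ENNReal.ofReal l * (1 + 1) := by
        gcongr
        exact h.2
    _ = _ := by rw [one_add_one_eq_two]

theorem luxNorm_sub_comm (u v : ℝ → E) :
    luxNorm p (fun x => u x - v x) = luxNorm p (fun x => v x - u x) := by
  unfold luxNorm
  simp only [norm_sub_rev]

theorem luxNorm_self (hp1 : ∀ x ∈ Set.Icc (0:ℝ) 1, 1 ≤ p x) (u : ℝ → E) :
    luxNorm p (fun x => u x - u x) = 0 := by
  refine le_antisymm (le_of_forall_pos_le_add fun ε hε => ?_) (luxNorm_nonneg _)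
  rw [zero_add]
  refine luxNorm_le ⟨hε, ?_⟩
  have : rhoVar p (fun x => ‖u x - u x‖ / ε) ≤ ∫⁻ x in Set.Icc (0:ℝ) 1, 0 := by
    refine setLIntegral_mono' measurableSet_Icc fun x hx => ?_
    simp [phiVar_zero p x (hp1 x hx)]
  refine this.trans ?_
  simp

theorem ap_imp_aa [CompleteSpace E] (hp : Measurable p)
    (hp1 : ∀ x ∈ Set.Icc (0:ℝ) 1, 1 ≤ p x) {g : ℝ → E} (hg : APSVar p Set.univ g) :
    AASVar p g := by
  obtain ⟨hS, hc, hap⟩ := hg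
  refine ⟨hS, fun a => ?_⟩
  obtain ⟨hmem, M, hM⟩ := hS
  replace hmem : ∀ t, MemLpVar p (fun x => g (t + x)) := fun t => hmem t (Set.mem_univ t)
  replace hM : ∀ t, luxNorm p (fun x => g (t + x)) ≤ M := fun t =>
    hM (Set.mem_image_of_mem _ (Set.mem_univ t))
  have hmemd : ∀ s t, MemLpVar p (fun x => g (s + x) - g (t + x)) := fun s t =>
    memLpVar_sub hp hp1 (hmem s) (hmem t)
  obtain ⟨n, hn, hn2⟩ := ap_bochner (fun s t => luxNorm p (fun x => g (s + x) - g (t + x)))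
    (fun s => luxNorm_self hp1 _) (fun s t => luxNorm_sub_comm _ _)
    (fun r s t => luxNorm_add hp hp1 (hmemd r s) (hmemd s t)
      (fun x => norm_sub_le_norm_sub_add_norm_sub _ _ _))
    (fun t => by simpa [nhdsWithin_univ] using hc t (Set.mem_univ t))
    (fun ε hε => by
      obtain ⟨l, hl, h⟩ := hap ε hε
      refine ⟨l, hl, fun a => ?_⟩
      obtain ⟨τ, h1, h2⟩ := h a (Set.subset_univ _)
      exact ⟨τ, h1, fun t => h2 t (Set.mem_univ t)⟩)
    (M + M) (fun s t => (luxNorm_add hp hp1 (hmem s) (hmem t)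
      (fun x => norm_sub_le _ _)).trans (add_le_add (hM s) (hM t))) a
  obtain ⟨m, hm, hm2⟩ := extraction_forall_of_eventually'
    (P := fun k N => ∀ j ≥ N, ∀ i ≥ N, ∀ t,
      luxNorm p (fun x => g (a (n j) + t + x) - g (a (n i) + t + x)) ≤ (1 / 2 : ℝ) ^ k)
    (fun k => by
      obtain ⟨N, hN⟩ := hn2 ((1 / 2 : ℝ) ^ k) (by positivity)
      exact ⟨N, fun K hK j hj i hi t => hN j (hK.trans hj) i (hK.trans hi) t⟩)
  set b : ℕ → ℝ := fun k => a (n (m k)) with hb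
  have hbG : ∀ k j, k ≤ j → ∀ t,
      LuxG p (fun x => g (b j + t + x) - g (b k + t + x)) (2 * (1 / 2 : ℝ) ^ k) := by
    intro k j hkj t
    refine luxG_of_lt hp1 (hmemd _ _) (lt_of_le_of_lt (hm2 k (m j) (hm.monotone hkj) (m k) le_rfl t) ?_)
    have : (0 : ℝ) < (1 / 2 : ℝ) ^ k := by positivity
    linarith
  let h : ℝ → E := fun y => limUnder atTop (fun k => g (b k + y))
  have hlim : ∀ t, ∀ᵐ x ∂(volume.restrict (Set.Icc (0:ℝ) 1)),
      Tendsto (fun k => g (b k + t + x)) atTop (𝓝 (h (t + x))) := by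
    intro t
    have hint : ∫⁻ x in Set.Icc (0:ℝ) 1, ∑' k, ‖g (b (k + 1) + t + x) - g (b k + t + x)‖ₑ ≠ ∞ := by
      rw [lintegral_tsum fun k => (hmemd _ _).1.enorm]
      refine ne_top_of_le_ne_top ?_
        (ENNReal.tsum_le_tsum fun k => luxG_l1 hp1 (hbG k (k + 1) (Nat.le_succ k) t))
      rw [ENNReal.tsum_mul_right]
      refine ENNReal.mul_ne_top ?_ (by simp)
      rw [← ENNReal.ofReal_tsum_of_nonneg (fun k => by positivity)
        ((summable_geometric_two).mul_left 2)]
      exact ENNReal.ofReal_ne_top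
    have hae := ae_lt_top' (AEMeasurable.tsum fun k => (hmemd _ _).1.enorm) hint
    filter_upwards [hae] with x hx
    have hC : CauchySeq (fun k => g (b k + t + x)) := by
      refine cauchySeq_of_edist_le_of_tsum_ne_top _ (fun k => ?_) hx.ne
      rw [edist_comm, edist_eq_enorm_sub]
    have := hC.tendsto_limUnder
    simpa [h, add_assoc] using this
  have hhm : ∀ t, AEStronglyMeasurable (fun x => h (t + x)) (volume.restrict (Set.Icc (0:ℝ) 1)) :=
    fun t => aestronglyMeasurable_of_tendsto_ae atTop (fun k => (hmem (b k + t)).1) (hlim t)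
  have hhG : ∀ t, LuxG p (fun x => h (t + x)) (M + 1) := fun t =>
    luxG_fatou hp hp1 (fun k => (hmem (b k + t)).1)
      (fun k => luxG_of_lt hp1 (hmem (b k + t)) (by linarith [hM (b k + t)])) (hlim t)
  have hdG : ∀ k t, LuxG p (fun x => h (t + x) - g (b k + t + x)) (2 * (1 / 2 : ℝ) ^ k) := by
    intro k t
    refine luxG_fatou hp hp1 (u := fun j x => g (b (j + k) + t + x) - g (b k + t + x))
      (fun j => (hmemd _ _).1) (fun j => hbG k (j + k) (Nat.le_add_left _ _) t) ?_
    filter_upwards [hlim t] with x hx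
    exact (hx.comp (tendsto_add_atTop_nat k)).sub_const _
  have hgeo : Tendsto (fun k : ℕ => 2 * (1 / 2 : ℝ) ^ k) atTop (𝓝 0) := by
    simpa using (tendsto_pow_atTop_nhds_zero_of_lt_one (r := (1 / 2 : ℝ))
      (by norm_num) (by norm_num)).const_mul 2
  refine ⟨n ∘ m, hn.comp hm, h, ⟨fun t _ => memLpVar_of_luxG (hhm t) (hhG t), M + 1, ?_⟩,
    fun t => ⟨?_, ?_⟩⟩
  · rintro _ ⟨t, -, rfl⟩
    exact luxNorm_le (hhG t)
  · refine squeeze_zero (fun k => luxNorm_nonneg _) (fun k => ?_) hgeo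
    rw [luxNorm_sub_comm]
    exact luxNorm_le (hdG k t)
  · refine squeeze_zero (fun k => luxNorm_nonneg _) (fun k => ?_) hgeo
    have := luxNorm_le (hdG k (t - b k))
    simpa using this

end lux

/-- every asymptotically Stepanov p(x)-almost periodic function on [0,∞)
is asymptotically Stepanov p(x)-almost automorphic. -/
theorem asymp_stepanov_px_ap_implies_asymp_aa
    {X : Type*} [NormedAddCommGroup X] [NormedSpace ℂ X] [CompleteSpace X]
    (p : ℝ → ℝ≥0∞) (hpmeas : Measurable p) (hp1 : ∀ x ∈ Set.Icc (0:ℝ) 1, 1 ≤ p x)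
    (f g q : ℝ → X)
    (hfS : SBdd p (Set.Ici 0) f)
    (hg : APSVar p Set.univ g)
    (hq : SBdd p (Set.Ici 0) q)
    (hq0 : Filter.Tendsto (fun t => luxNorm p (fun x => q (t + x))) Filter.atTop (nhds 0))
    (hdec : ∀ t : ℝ, 0 ≤ t → f t = g t + q t) :
    AAASVar p f := by
  exact ⟨hfS, g, q, ap_imp_aa hpmeas hp1 hg, hq, hdec, hq0⟩

end
end

section
/- Let p, q : [0,1] → [1,∞] be Lebesgue measurable with p(x) ≤ q(x) for a.e. x ∈ [0,1]. Then AAS^{q(x)}(ℝ:X) ⊆ AAS^{p(x)}(ℝ:X), and the embedding is continuous with respect to the Stepanov norms ‖·‖_{S^{q(x)}} and ‖·‖_{S^{p(x)}}. -/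
open MeasureTheory Filter Topology Set
open scoped ENNReal

noncomputable section

theorem phi_le_add_one (p q : ℝ → ℝ≥0∞) (x t : ℝ) (ht : 0 ≤ t) (h : p x ≤ q x) :
    phiVar p x t ≤ 1 + phiVar q x t := by
  unfold phiVar
  by_cases hq : q x = ∞
  · simp only [hq, ne_eq, not_true_eq_false, if_false]
    by_cases h1 : t ≤ 1
    · simp only [h1, if_true, add_zero]
      split_ifs
      · exact zero_le
      · rw [← ENNReal.ofReal_one]
        exact ENNReal.ofReal_le_ofReal (Real.rpow_le_one ht h1 ENNReal.toReal_nonneg)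
    · simp [h1]
  · have hp : p x ≠ ∞ := ne_top_of_le_ne_top hq h
    simp only [hq, hp, ne_eq, not_false_eq_true, if_true]
    have hpq := ENNReal.toReal_mono hq h
    rw [← ENNReal.ofReal_one, ← ENNReal.ofReal_add zero_le_one (Real.rpow_nonneg ht _)]
    apply ENNReal.ofReal_le_ofReal
    by_cases h1 : t ≤ 1
    · have := Real.rpow_le_one ht h1 (ENNReal.toReal_nonneg (a := p x))
      have := Real.rpow_nonneg ht (q x).toReal
      linarith
    · have := Real.rpow_le_rpow_of_exponent_le (not_le.mp h1).le hpq
      linarith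

theorem phi_mono (p : ℝ → ℝ≥0∞) (x s t : ℝ) (hs : 0 ≤ s) (h : s ≤ t) :
    phiVar p x s ≤ phiVar p x t := by
  unfold phiVar
  split_ifs with h1 h2 h3 h4
  · exact ENNReal.ofReal_le_ofReal (Real.rpow_le_rpow hs h ENNReal.toReal_nonneg)
  · exact le_rfl
  · exact zero_le
  · exact absurd (h.trans h4) h2
  · exact le_rfl

theorem phi_div (p : ℝ → ℝ≥0∞) (x t M : ℝ) (ht : 0 ≤ t) (hM : 1 ≤ M) (hp : 1 ≤ p x) :
    phiVar p x (t / M) ≤ ENNReal.ofReal M⁻¹ * phiVar p x t := by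
  have hM0 : 0 < M := by linarith
  unfold phiVar
  split_ifs with h1 h2 h3 h4
  · rw [← ENNReal.ofReal_mul (inv_nonneg.mpr hM0.le)]
    apply ENNReal.ofReal_le_ofReal
    have hp' : 1 ≤ (p x).toReal := by
      simpa using ENNReal.toReal_mono h1 hp
    rw [div_eq_inv_mul, Real.mul_rpow (inv_nonneg.mpr hM0.le) ht]
    apply mul_le_mul_of_nonneg_right _ (Real.rpow_nonneg ht _)
    calc M⁻¹ ^ (p x).toReal ≤ M⁻¹ ^ (1:ℝ) :=
          Real.rpow_le_rpow_of_exponent_ge (inv_pos.mpr hM0) (inv_le_one_of_one_le₀ hM) hp'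
      _ = M⁻¹ := Real.rpow_one _
  · exact zero_le
  · exact zero_le
  · exact absurd ((div_le_self ht hM).trans h4) h2
  · rw [ENNReal.mul_top]
    simpa using hM0

theorem rho_div (p : ℝ → ℝ≥0∞) (hp1 : ∀ x ∈ Set.Icc (0:ℝ) 1, 1 ≤ p x) (u : ℝ → ℝ)
    (hu : ∀ x, 0 ≤ u x) (M : ℝ) (hM : 1 ≤ M) :
    rhoVar p (fun x => u x / M) ≤ ENNReal.ofReal M⁻¹ * rhoVar p u := by
  unfold rhoVar
  rw [← lintegral_const_mul' _ _ ENNReal.ofReal_ne_top]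
  apply lintegral_mono_ae
  filter_upwards [ae_restrict_mem measurableSet_Icc] with x hx
  exact phi_div p x _ M (hu x) hM (hp1 x hx)

theorem rho_le (p q : ℝ → ℝ≥0∞) (u : ℝ → ℝ) (hu : ∀ x, 0 ≤ u x)
    (hpq : ∀ᵐ x ∂(MeasureTheory.volume.restrict (Set.Icc (0:ℝ) 1)), p x ≤ q x) :
    rhoVar p u ≤ 1 + rhoVar q u := by
  unfold rhoVar
  calc _ ≤ ∫⁻ x in Set.Icc (0:ℝ) 1, (1 + phiVar q x (u x)) := by
        apply lintegral_mono_ae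
        filter_upwards [hpq] with x hx
        exact phi_le_add_one p q x _ (hu x) hx
    _ = _ := by
        rw [lintegral_add_left measurable_const]
        simp

theorem phi_meas (p : ℝ → ℝ≥0∞) (hp : Measurable p) (u : ℝ → ℝ) (μ : Measure ℝ)
    (hu : AEMeasurable u μ) : AEMeasurable (fun x => phiVar p x (u x)) μ := by
  have h : Measurable (fun z : ℝ≥0∞ × ℝ => if z.1 ≠ ∞ then ENNReal.ofReal (z.2 ^ z.1.toReal)
      else if z.2 ≤ 1 then 0 else (∞ : ℝ≥0∞)) := by
    apply Measurable.ite
    · exact (measurable_fst (measurableSet_singleton ∞)).compl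
    · fun_prop
    · apply Measurable.ite
      · exact measurableSet_le measurable_snd measurable_const
      · exact measurable_const
      · exact measurable_const
  exact h.comp_aemeasurable (hp.aemeasurable.prodMk hu)

theorem memLp_sub {E : Type*} [NormedAddCommGroup E] (p : ℝ → ℝ≥0∞) (hp : Measurable p)
    (f g : ℝ → E) (hf : MemLpVar p f) (hg : MemLpVar p g) :
    MemLpVar p (fun x => f x - g x) := by
  obtain ⟨hfm, c, hc, hfc⟩ := hf
  obtain ⟨hgm, d, hd, hgd⟩ := hg
  refine ⟨hfm.sub hgm, min c d / 2, by positivity, ?_⟩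
  have hle : rhoVar p (fun x => min c d / 2 * ‖f x - g x‖) ≤
      rhoVar p (fun x => c * ‖f x‖) + rhoVar p (fun x => d * ‖g x‖) := by
    unfold rhoVar
    rw [← lintegral_add_left' (phi_meas p hp _ _ (hfm.norm.aemeasurable.const_mul c))]
    apply lintegral_mono
    intro x
    have hm : 0 < min c d := lt_min hc hd
    have h1 := norm_sub_le (f x) (g x)
    have h2 : min c d * ‖f x‖ ≤ c * ‖f x‖ :=
      mul_le_mul_of_nonneg_right (min_le_left _ _) (norm_nonneg _)
    have h3 : min c d * ‖g x‖ ≤ d * ‖g x‖ :=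
      mul_le_mul_of_nonneg_right (min_le_right _ _) (norm_nonneg _)
    have h4 : min c d * ‖f x - g x‖ ≤ min c d * (‖f x‖ + ‖g x‖) :=
      mul_le_mul_of_nonneg_left h1 hm.le
    have h0 : 0 ≤ min c d / 2 * ‖f x - g x‖ := by positivity
    rcases le_total (c * ‖f x‖) (d * ‖g x‖) with h | h
    · exact (phi_mono p x _ _ h0 (by nlinarith)).trans le_add_self
    · exact (phi_mono p x _ _ h0 (by nlinarith)).trans le_self_add
  exact hle.trans_lt (ENNReal.add_lt_top.mpr ⟨hfc, hgd⟩)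

theorem lux_nonempty {E : Type*} [NormedAddCommGroup E] (p : ℝ → ℝ≥0∞)
    (hp1 : ∀ x ∈ Set.Icc (0:ℝ) 1, 1 ≤ p x) (f : ℝ → E) (hf : MemLpVar p f) :
    {lam : ℝ | 0 < lam ∧ rhoVar p (fun x => ‖f x‖ / lam) ≤ 1}.Nonempty := by
  obtain ⟨_, c, hc, hfc⟩ := hf
  set R := (rhoVar p (fun x => c * ‖f x‖)).toReal with hR
  have hR0 : 0 ≤ R := ENNReal.toReal_nonneg
  have h := rho_div p hp1 (fun x => c * ‖f x‖) (fun x => by positivity) (R + 1) (by linarith)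
  refine ⟨(R + 1) / c, by positivity, ?_⟩
  have he : (fun x => ‖f x‖ / ((R + 1) / c)) = fun x => c * ‖f x‖ / (R + 1) := by
    funext x
    field_simp
  rw [he]
  refine h.trans ?_
  rw [← ENNReal.ofReal_toReal hfc.ne, ← hR, ← ENNReal.ofReal_mul (by positivity),
    ← ENNReal.ofReal_one]
  apply ENNReal.ofReal_le_ofReal
  rw [inv_mul_le_iff₀ (by positivity)]
  linarith

theorem lux_nonneg {E : Type*} [NormedAddCommGroup E] (p : ℝ → ℝ≥0∞) (f : ℝ → E) :
    0 ≤ luxNorm p f := Real.sInf_nonneg (fun _ h => h.1.le)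

theorem lux_le {E : Type*} [NormedAddCommGroup E] (p q : ℝ → ℝ≥0∞)
    (hp1 : ∀ x ∈ Set.Icc (0:ℝ) 1, 1 ≤ p x) (hq1 : ∀ x ∈ Set.Icc (0:ℝ) 1, 1 ≤ q x)
    (hpq : ∀ᵐ x ∂(MeasureTheory.volume.restrict (Set.Icc (0:ℝ) 1)), p x ≤ q x)
    (f : ℝ → E) (hf : MemLpVar q f) : luxNorm p f ≤ 2 * luxNorm q f := by
  suffices h : luxNorm p f / 2 ≤ luxNorm q f by linarith
  apply le_csInf (lux_nonempty q hq1 f hf)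
  rintro l ⟨hl, hr⟩
  suffices h : luxNorm p f ≤ 2 * l by linarith
  apply csInf_le ⟨0, fun _ h => h.1.le⟩
  refine ⟨by positivity, ?_⟩
  have h1 := rho_le p q (fun x => ‖f x‖ / l) (fun x => by positivity) hpq
  have h2 := rho_div p hp1 (fun x => ‖f x‖ / l) (fun x => by positivity) 2 (by norm_num)
  have he : (fun x => ‖f x‖ / (2 * l)) = fun x => ‖f x‖ / l / 2 := by
    funext x
    field_simp
  rw [he]
  refine h2.trans ?_
  calc _ ≤ ENNReal.ofReal 2⁻¹ * (1 + 1) := by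
        gcongr
        exact h1.trans (by gcongr)
    _ = 1 := by
        rw [← ENNReal.ofReal_one, ← ENNReal.ofReal_add (by norm_num) (by norm_num),
          ← ENNReal.ofReal_mul (by norm_num)]
        norm_num

theorem memLp_mono {E : Type*} [NormedAddCommGroup E] (p q : ℝ → ℝ≥0∞)
    (hpq : ∀ᵐ x ∂(MeasureTheory.volume.restrict (Set.Icc (0:ℝ) 1)), p x ≤ q x)
    (f : ℝ → E) (hf : MemLpVar q f) : MemLpVar p f := by
  obtain ⟨hm, c, hc, h⟩ := hf
  refine ⟨hm, c, hc, (rho_le p q _ (fun x => by positivity) hpq).trans_lt ?_⟩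
  exact ENNReal.add_lt_top.mpr ⟨ENNReal.one_lt_top, h⟩

theorem sBdd_mono {E : Type*} [NormedAddCommGroup E] (p q : ℝ → ℝ≥0∞)
    (hp1 : ∀ x ∈ Set.Icc (0:ℝ) 1, 1 ≤ p x) (hq1 : ∀ x ∈ Set.Icc (0:ℝ) 1, 1 ≤ q x)
    (hpq : ∀ᵐ x ∂(MeasureTheory.volume.restrict (Set.Icc (0:ℝ) 1)), p x ≤ q x)
    (f : ℝ → E) (hf : SBdd q Set.univ f) : SBdd p Set.univ f := by
  obtain ⟨h1, B, hB⟩ := hf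
  refine ⟨fun t ht => memLp_mono p q hpq _ (h1 t ht), 2 * B, ?_⟩
  rintro _ ⟨t, ht, rfl⟩
  have := lux_le p q hp1 hq1 hpq _ (h1 t ht)
  have h2 := hB ⟨t, ht, rfl⟩
  dsimp only at h2 ⊢
  linarith

/-- if p ≤ q a.e., then AAS^{q(x)}(ℝ:X) ⊆ AAS^{p(x)}(ℝ:X)
with a continuous embedding. -/
theorem aas_monotone_exponent_embedding
    {X : Type*} [NormedAddCommGroup X] [NormedSpace ℂ X] [CompleteSpace X]
    (p q : ℝ → ℝ≥0∞) (hpmeas : Measurable p) (hqmeas : Measurable q)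
    (hp1 : ∀ x ∈ Set.Icc (0:ℝ) 1, 1 ≤ p x) (hq1 : ∀ x ∈ Set.Icc (0:ℝ) 1, 1 ≤ q x)
    (hpq : ∀ᵐ x ∂(MeasureTheory.volume.restrict (Set.Icc (0:ℝ) 1)), p x ≤ q x) :
    (∀ f : ℝ → X, AASVar q f → AASVar p f) ∧
    ∃ c : ℝ, 0 < c ∧ ∀ f : ℝ → X, AASVar q f →
      SNorm p Set.univ f ≤ c * SNorm q Set.univ f := by
  constructor
  · rintro f ⟨hfb, hf⟩
    refine ⟨sBdd_mono p q hp1 hq1 hpq f hfb, fun a => ?_⟩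
    obtain ⟨n, hn, g, hg, h⟩ := hf a
    refine ⟨n, hn, g, sBdd_mono p q hp1 hq1 hpq g hg, fun t => ⟨?_, ?_⟩⟩
    · refine squeeze_zero (fun _ => lux_nonneg _ _) (fun k => lux_le p q hp1 hq1 hpq _ ?_)
        (by simpa using (h t).1.const_mul 2)
      exact memLp_sub q hqmeas _ _ (hfb.1 _ (mem_univ _)) (hg.1 _ (mem_univ _))
    · refine squeeze_zero (fun _ => lux_nonneg _ _) (fun k => lux_le p q hp1 hq1 hpq _ ?_)
        (by simpa using (h t).2.const_mul 2)
      exact memLp_sub q hqmeas _ _ (hg.1 _ (mem_univ _)) (hfb.1 _ (mem_univ _))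
  · refine ⟨2, by norm_num, fun f hf => ?_⟩
    apply csSup_le (univ_nonempty.image _)
    rintro _ ⟨t, ht, rfl⟩
    refine (lux_le p q hp1 hq1 hpq _ (hf.1.1 t ht)).trans ?_
    apply mul_le_mul_of_nonneg_left _ (by norm_num)
    exact le_csSup hf.1.2 ⟨t, ht, rfl⟩

end
end
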